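/- For every ε > 0 and β ∈ (0,1], there exist δ > 0 and positive integers d, n₀ such that for all n ≥ n₀ there exists a d-left-regular bipartite graph with n left vertices and at most βn right vertices that is a (δ, 1−ε)-unique neighbor expander. -/

import Mathlib

open Finset in
/-- Twice the image size is at most the domain size plus the number of uniquely attained values. -/
theorem two_mul_card_image_le {ι γ : Type*} [DecidableEq γ] [Fintype γ] (φ : ι → γ)
    (T : Finset ι) :
    2 * #(T.image φ) ≤ #T + #{v | #{p ∈ T | φ p = v} = 1} := by
  have h1 : #{v | #{p ∈ T | φ p = v} = 1} =
      ∑ v ∈ T.image φ, if #{p ∈ T | φ p = v} = 1 then 1 else 0 := by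
    rw [← card_filter]
    congr 1
    ext v
    simp only [mem_filter, mem_univ, true_and, mem_image, iff_and_self]
    intro h
    obtain ⟨p, hp⟩ := card_pos.1 (h ▸ one_pos)
    exact ⟨p, (mem_filter.1 hp).1, (mem_filter.1 hp).2⟩
  rw [h1, card_eq_sum_card_image φ T, ← sum_add_distrib, mul_comm, ← smul_eq_mul, ← sum_const]
  refine sum_le_sum fun v hv => ?_
  obtain ⟨p, hp, hpv⟩ := mem_image.1 hv
  have : 0 < #{p ∈ T | φ p = v} := card_pos.2 ⟨p, mem_filter.2 ⟨hp, hpv⟩⟩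
  split_ifs <;> omega

open Finset in
/-- At most a fraction `1 / |κ| ^ |A|` of all functions copy their values on `A` along a map `g`
with values off `A`. -/
theorem card_determined_mul_le {ι κ : Type*} [Fintype ι] [DecidableEq ι] [Fintype κ]
    [DecidableEq κ] (A : Finset ι) (g : A → ι) (hg : ∀ a, g a ∉ A) :
    #{f : ι → κ | ∀ a : A, f a = f (g a)} * Fintype.card κ ^ #A ≤
      Fintype.card κ ^ Fintype.card ι := by
  have h : #{f : ι → κ | ∀ a : A, f a = f (g a)} ≤
      Fintype.card ({p // p ∉ A} → κ) := by
    refine card_le_card_of_injOn (fun f p => f p) (fun _ _ => mem_univ _) ?_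
    intro f hf f' hf' hff
    have hoff : ∀ p, p ∉ A → f p = f' p := fun p hp => congrFun hff ⟨p, hp⟩
    funext p
    by_cases hp : p ∈ A
    · have e := (mem_filter.1 hf).2 ⟨p, hp⟩
      have e' := (mem_filter.1 hf').2 ⟨p, hp⟩
      simp only at e e'
      rw [e, e', hoff _ (hg _)]
    · exact hoff p hp
  calc _ ≤ Fintype.card ({p // p ∉ A} → κ) * Fintype.card κ ^ #A := by gcongr
    _ = _ := by
      rw [Fintype.card_fun, ← pow_add, Fintype.card_subtype_compl, Fintype.card_coe,
        Nat.sub_add_cancel (card_le_univ A)]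

open Finset in
/-- A function with at least `r` collisions on `T` copies its values on some `r`-subset of `T`
from other points of `T`. -/
theorem exists_determined_of_card_image_add_le {ι κ γ : Type*} [DecidableEq ι] [DecidableEq γ]
    (c : ι → κ → γ) (hc : ∀ p q x y, c p x = c q y → x = y) (T : Finset ι) (r : ℕ) (f : ι → κ)
    (h : #(T.image fun p => c p (f p)) + r ≤ #T) :
    ∃ A ∈ T.powersetCard r, ∃ g : A → T, (∀ a, (g a : ι) ∉ A) ∧ ∀ a : A, f a = f (g a) := by
  have hs : ∀ v ∈ T.image fun p => c p (f p), ∃ p ∈ T, c p (f p) = v := fun v hv => mem_image.1 hv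
  choose s hsT hs using hs
  set R := (T.image fun p => c p (f p)).attach.image fun v => s v.1 v.2
  have hRT : R ⊆ T := by
    intro p hp
    obtain ⟨v, -, rfl⟩ := mem_image.1 hp
    exact hsT v v.2
  have hr : r ≤ #(T \ R) := by
    rw [card_sdiff_of_subset hRT]
    have : #R ≤ _ := card_image_le
    rw [card_attach] at this
    omega
  obtain ⟨A, hA, hAr⟩ := exists_subset_card_eq hr
  have hAT : A ⊆ T := hA.trans sdiff_subset
  have himg : ∀ a : A, c a (f a) ∈ T.image fun p => c p (f p) :=
    fun a => mem_image_of_mem (fun p => c p (f p)) (hAT a.2)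
  refine ⟨A, mem_powersetCard.2 ⟨hAT, hAr⟩, fun a => ⟨s _ (himg a), hsT _ (himg a)⟩, ?_, ?_⟩
  · intro a ha
    exact (mem_sdiff.1 (hA ha)).2 (mem_image.2 ⟨⟨_, himg a⟩, mem_attach _ _, rfl⟩)
  · intro a
    exact (hc _ _ _ _ (hs _ (himg a))).symm

open Finset in
/-- A union bound for the functions with at least `r` collisions on `T`. -/
theorem card_collisions_mul_le {ι κ γ : Type*} [Fintype ι] [DecidableEq ι] [Fintype κ]
    [DecidableEq κ] [DecidableEq γ] (c : ι → κ → γ) (hc : ∀ p q x y, c p x = c q y → x = y)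
    (T : Finset ι) (r : ℕ) :
    #{f : ι → κ | #(T.image fun p => c p (f p)) + r ≤ #T} * Fintype.card κ ^ r ≤
      2 ^ #T * #T ^ r * Fintype.card κ ^ Fintype.card ι := by
  classical
  set D : (A : Finset ι) → (A → T) → Finset (ι → κ) := fun A g =>
    if ∀ a, (g a : ι) ∉ A then univ.filter fun f => ∀ a : A, f a = f (g a) else ∅
  have hsub : ({f : ι → κ | #(T.image fun p => c p (f p)) + r ≤ #T} : Finset (ι → κ)) ⊆
      (T.powersetCard r).biUnion fun A => univ.biUnion (D A) := by
    intro f hf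
    obtain ⟨A, hA, g, hg, hfg⟩ :=
      exists_determined_of_card_image_add_le c hc T r f (mem_filter.1 hf).2
    refine mem_biUnion.2 ⟨A, hA, mem_biUnion.2 ⟨g, mem_univ _, ?_⟩⟩
    simp only [D, if_pos hg]
    exact mem_filter.2 ⟨mem_univ _, hfg⟩
  have hD : ∀ A ∈ T.powersetCard r, ∀ g, #(D A g) * Fintype.card κ ^ r ≤
      Fintype.card κ ^ Fintype.card ι := by
    intro A hA g
    simp only [D]
    split_ifs with hg
    · rw [← (mem_powersetCard.1 hA).2]
      exact card_determined_mul_le A (fun a => g a) hg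
    · simp
  calc _ ≤ (∑ A ∈ T.powersetCard r, ∑ g, #(D A g)) * Fintype.card κ ^ r := by
        gcongr
        refine (card_le_card hsub).trans (card_biUnion_le.trans ?_)
        gcongr
        exact card_biUnion_le
    _ = ∑ A ∈ T.powersetCard r, ∑ g, #(D A g) * Fintype.card κ ^ r := by
        simp only [sum_mul]
    _ ≤ ∑ A ∈ T.powersetCard r, ∑ _g : A → T, Fintype.card κ ^ Fintype.card ι := by
        gcongr with A hA g
        exact hD A hA g
    _ = ∑ A ∈ T.powersetCard r, #T ^ r * Fintype.card κ ^ Fintype.card ι := by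
        refine sum_congr rfl fun A hA => ?_
        simp [(mem_powersetCard.1 hA).2]
    _ ≤ _ := by
        rw [sum_const, card_powersetCard, smul_eq_mul, mul_assoc]
        gcongr
        exact Nat.choose_le_two_pow _ _

theorem choose_mul_pow_self_le (n s : ℕ) : (n.choose s : ℝ) * s ^ s ≤ (3 * n) ^ s := by
  have h1 := Nat.choose_le_pow_div (α := ℝ) s n
  have h2 := Real.pow_div_factorial_le_exp (s : ℝ) (Nat.cast_nonneg s) s
  have h3 : Real.exp s ≤ 3 ^ s := by
    rw [← mul_one (s : ℝ), Real.exp_nat_mul]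
    gcongr
    exact Real.exp_one_lt_d9.le.trans (by norm_num)
  calc (n.choose s : ℝ) * s ^ s ≤ (n ^ s / s.factorial) * s ^ s := by gcongr
    _ = n ^ s * (s ^ s / s.factorial) := by ring
    _ ≤ n ^ s * 3 ^ s := by gcongr; exact h2.trans h3
    _ = _ := by rw [← mul_pow, mul_comm]

open Finset in
/-- A map whose collision count on every small `S × Fin d` is less than `2 |S|`. -/
theorem exists_few_collisions {n d k : ℕ} {δ : ℝ} (hk : 0 < k)
    (hδ : 3 * n * (2 ^ d * d ^ 2 * (δ * n)) ≤ (k : ℝ) ^ 2 / 2) :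
    ∃ f : Fin n × Fin d → Fin k, ∀ S : Finset (Fin n), S.Nonempty → (#S : ℝ) < δ * n →
      d * #S < #((S ×ˢ univ).image fun p => (p.2, f p)) + 2 * #S := by
  classical
  set B : Finset (Fin n) → Finset (Fin n × Fin d → Fin k) := fun S =>
    {f | #((S ×ˢ univ).image fun p => (p.2, f p)) + 2 * #S ≤ #(S ×ˢ (univ : Finset (Fin d)))}
  set I : Finset ℕ := {s ∈ Ico 1 (n + 1) | (s : ℝ) < δ * n}
  have hB : ∀ S, (#(B S) : ℝ) * (k ^ 2) ^ #S ≤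
      (2 ^ d * d ^ 2 * #S) ^ #S * #S ^ #S * k ^ (n * d) := by
    intro S
    have h := card_collisions_mul_le (ι := Fin n × Fin d) (κ := Fin k) (fun p x => (p.2, x))
      (fun _ _ _ _ h => (Prod.ext_iff.1 h).2) (S ×ˢ univ) (2 * #S)
    simp only [Fintype.card_fin, Fintype.card_prod] at h
    have h' : (#(B S) : ℝ) * k ^ (2 * #S) ≤ 2 ^ (#S * d) * (#S * d) ^ (2 * #S) * k ^ (n * d) := by
      simpa [B, card_product] using (Nat.cast_le (α := ℝ)).2 h
    calc _ = (#(B S) : ℝ) * k ^ (2 * #S) := by rw [pow_mul]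
      _ ≤ _ := h'
      _ = _ := by
        rw [mul_comm #S d, pow_mul, pow_mul, ← mul_pow, ← mul_pow]
        congr 2
        ring
  have hsum : ∀ s ∈ I, ∑ S ∈ powersetCard s univ, (#(B S) : ℝ) ≤ (1 / 2) ^ s * k ^ (n * d) := by
    intro s hs
    have hsδ : (s : ℝ) < δ * n := (mem_filter.1 hs).2
    have hk2 : (0 : ℝ) < (k ^ 2) ^ s := by positivity
    refine le_of_mul_le_mul_right ?_ hk2
    calc (∑ S ∈ powersetCard s univ, (#(B S) : ℝ)) * (k ^ 2) ^ s
        ≤ ∑ S ∈ powersetCard s (univ : Finset (Fin n)),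
            (2 ^ d * d ^ 2 * (s : ℝ)) ^ s * s ^ s * k ^ (n * d) := by
          rw [sum_mul]
          refine sum_le_sum fun S hS => ?_
          simpa only [(mem_powersetCard.1 hS).2] using hB S
      _ = (n.choose s * (s : ℝ) ^ s) * (2 ^ d * d ^ 2 * (s : ℝ)) ^ s * k ^ (n * d) := by
          rw [sum_const, card_powersetCard, card_univ, Fintype.card_fin, nsmul_eq_mul]
          ring
      _ ≤ (3 * n) ^ s * (2 ^ d * d ^ 2 * (δ * n)) ^ s * k ^ (n * d) := by
          gcongr
          exact choose_mul_pow_self_le n s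
      _ ≤ ((k : ℝ) ^ 2 / 2) ^ s * k ^ (n * d) := by
          rw [← mul_pow]
          have : (0 : ℝ) ≤ δ * n := (Nat.cast_nonneg s).trans hsδ.le
          gcongr
      _ = _ := by rw [div_pow, one_div, inv_pow]; ring
  have hgeom : ∑ s ∈ I, (1 / 2 : ℝ) ^ s < 1 := by
    calc ∑ s ∈ I, (1 / 2 : ℝ) ^ s ≤ ∑ s ∈ Ico 1 (n + 1), (1 / 2 : ℝ) ^ s :=
          sum_le_sum_of_subset_of_nonneg (filter_subset _ _) fun _ _ _ => by positivity
      _ = 1 - (1 / 2) ^ n := by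
          rw [geom_sum_Ico (by norm_num) (by omega), pow_succ]
          ring
      _ < 1 := by
          have : (0 : ℝ) < (1 / 2) ^ n := by positivity
          linarith
  have hcard : #(I.biUnion fun s => (powersetCard s univ).biUnion B) <
      #(univ : Finset (Fin n × Fin d → Fin k)) := by
    rw [card_univ, Fintype.card_fun, Fintype.card_prod, Fintype.card_fin, Fintype.card_fin,
      Fintype.card_fin, ← Nat.cast_lt (α := ℝ)]
    calc (#(I.biUnion fun s => (powersetCard s univ).biUnion B) : ℝ)
        ≤ ∑ s ∈ I, ∑ S ∈ powersetCard s univ, (#(B S) : ℝ) := by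
          exact_mod_cast card_biUnion_le.trans (sum_le_sum fun s _ => card_biUnion_le)
      _ ≤ ∑ s ∈ I, (1 / 2) ^ s * (k : ℝ) ^ (n * d) := sum_le_sum hsum
      _ = (∑ s ∈ I, (1 / 2 : ℝ) ^ s) * (k : ℝ) ^ (n * d) := (sum_mul ..).symm
      _ < 1 * (k : ℝ) ^ (n * d) := by gcongr
      _ = _ := by rw [one_mul, Nat.cast_pow]
  obtain ⟨f, -, hf⟩ := exists_mem_notMem_of_card_lt_card hcard
  refine ⟨f, fun S hS hSδ => ?_⟩
  by_contra! hcon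
  refine hf (mem_biUnion.2 ⟨#S, ?_, mem_biUnion.2 ⟨S, mem_powersetCard.2 ⟨subset_univ _, rfl⟩, ?_⟩⟩)
  · have : #S ≤ n := by simpa using card_le_univ S
    exact mem_filter.2 ⟨mem_Ico.2 ⟨hS.card_pos, by omega⟩, hSδ⟩
  · refine mem_filter.2 ⟨mem_univ _, ?_⟩
    rwa [card_product, card_univ, Fintype.card_fin, mul_comm #S d]

open Finset in
/-- The bipartite graph of `f`, whose right side consists of `d` blocks of size `k`, has at least
`2 |N(S)| - d |S|` unique neighbors of `S`. -/
theorem two_mul_card_image_le_ncard_unique {n d k : ℕ} (f : Fin n × Fin d → Fin k)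
    (S : Finset (Fin n)) :
    2 * #((S ×ˢ univ).image fun p => (p.2, f p)) ≤ d * #S +
      {v : Fin (d * k) | ∃! u, u ∈ S ∧ ∃ i, finProdFinEquiv (i, f (u, i)) = v}.ncard := by
  classical
  have h := two_mul_card_image_le (fun p => (p.2, f p)) (S ×ˢ (univ : Finset (Fin d)))
  rw [card_product, card_univ, Fintype.card_fin, mul_comm #S d] at h
  refine h.trans (Nat.add_le_add_left ?_ _)
  rw [← Set.ncard_coe_finset]
  refine Set.ncard_le_ncard_of_injOn finProdFinEquiv ?_ finProdFinEquiv.injective.injOn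
    (Set.toFinite _)
  intro v hv
  obtain ⟨p, hp⟩ := card_eq_one.1 (mem_filter.1 (mem_coe.1 hv)).2
  have hmem : ∀ q : Fin n × Fin d, (q.1 ∈ S ∧ (q.2, f q) = v) ↔ q = p := by
    intro q
    simpa using Finset.ext_iff.1 hp q
  obtain ⟨hpS, hpv⟩ := (hmem p).2 rfl
  refine ⟨p.1, ⟨hpS, p.2, congrArg _ hpv⟩, ?_⟩
  rintro u ⟨hu, i, hi⟩
  exact congrArg Prod.fst ((hmem (u, i)).1 ⟨hu, finProdFinEquiv.injective hi⟩)


/-- Non-explicit unique neighbor expanders: for every `ε > 0` and `β ∈ (0,1]`, there exist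
`δ > 0` and positive integers `d, n₀` such that for all `n ≥ n₀` there is a `d`-left-regular
bipartite graph with `n` left vertices and at most `βn` right vertices that is a
`(δ, 1-ε)`-unique neighbor expander. -/
theorem stmt14 (ε : ℝ) (hε : 0 < ε) (β : ℝ) (hβ0 : 0 < β) (hβ1 : β ≤ 1) :
    ∃ δ : ℝ, 0 < δ ∧ ∃ d n₀ : ℕ, 0 < d ∧ 0 < n₀ ∧
      ∀ n : ℕ, n₀ ≤ n → ∃ (m : ℕ) (Adj : Fin n → Fin m → Prop),
        (m : ℝ) ≤ β * n ∧
        (∀ u : Fin n, ({v : Fin m | Adj u v}).ncard = d) ∧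
        (∀ S : Set (Fin n), S.Nonempty → (S.ncard : ℝ) < δ * n →
          (1 - ε) * d * S.ncard ≤
            (({v : Fin m | ∃! u, u ∈ S ∧ Adj u v}).ncard : ℝ)) := by
  set d := ⌈4 / ε⌉₊
  have hd : 0 < d := Nat.ceil_pos.2 (by positivity)
  have hdε : 4 ≤ ε * d := by
    rw [mul_comm]
    exact (div_le_iff₀ hε).1 (Nat.le_ceil _)
  have hdR : (0 : ℝ) < d := Nat.cast_pos.2 hd
  refine ⟨β ^ 2 / (24 * 2 ^ d * d ^ 4), by positivity, d, ⌈2 * d / β⌉₊, hd,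
    Nat.ceil_pos.2 (by positivity), fun n hn => ?_⟩
  have hnβ : 2 * d ≤ β * n := by
    rw [mul_comm β]
    exact (div_le_iff₀ hβ0).1 (Nat.ceil_le.1 hn)
  set k := ⌊β * n / d⌋₊
  have hx : 2 ≤ β * n / d := (le_div_iff₀ hdR).2 hnβ
  have hk : 0 < k := Nat.floor_pos.2 (by linarith)
  have hk_le : (k : ℝ) ≤ β * n / d := Nat.floor_le (by positivity)
  have hk_ge : β * n / d / 2 ≤ k := by
    have := Nat.lt_floor_add_one (β * n / d)
    linarith
  obtain ⟨f, hf⟩ := exists_few_collisions (n := n) (d := d) (k := k)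
    (δ := β ^ 2 / (24 * 2 ^ d * d ^ 4)) hk <| by
      calc _ = (β * n / d / 2) ^ 2 / 2 := by field_simp; ring
        _ ≤ _ := by gcongr
  refine ⟨d * k, fun u v => ∃ i, finProdFinEquiv (i, f (u, i)) = v, ?_, fun u => ?_,
    fun S hS hSδ => ?_⟩
  · rw [Nat.cast_mul, mul_comm]
    exact (le_div_iff₀ hdR).1 hk_le
  · have hinj : Function.Injective fun i => finProdFinEquiv (i, f (u, i)) := fun i j hij =>
      congrArg Prod.fst (finProdFinEquiv.injective hij)
    change (Set.range fun i => finProdFinEquiv (i, f (u, i))).ncard = d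
    rw [← Set.image_univ, Set.ncard_image_of_injective _ hinj, Set.ncard_univ, Nat.card_fin]
  · lift S to Finset (Fin n) using S.toFinite
    rw [Set.ncard_coe_finset] at hSδ ⊢
    have h1 := hf S (by simpa using hS) hSδ
    have h2 := two_mul_card_image_le_ncard_unique f S
    simp only [Finset.mem_coe]
    have h3 : d * S.card ≤ {v : Fin (d * k) | ∃! u, u ∈ S ∧
        ∃ i, finProdFinEquiv (i, f (u, i)) = v}.ncard + 4 * S.card := by omega
    have h3R : (d : ℝ) * S.card ≤ ({v : Fin (d * k) | ∃! u, u ∈ S ∧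
        ∃ i, finProdFinEquiv (i, f (u, i)) = v}.ncard : ℝ) + 4 * S.card := by exact_mod_cast h3
    have h4 : 4 * (S.card : ℝ) ≤ ε * d * S.card := by gcongr
    linarith
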